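/- arXiv:1503.06554 — 2 statements merged into one kernel-verified Lean document; each statement's English description precedes it below -/
import Mathlib

section
/- For every 1 ≤ p ≤ ∞ there exists a constant C_p, independent of ε, such that for all ε ∈ (0,1] (with d_ε ≥ ε) the cutoff function φ^ε satisfies ‖1 − φ^ε‖_{L^p(ℝ²)} + ε ‖∇φ^ε‖_{L^p(ℝ²)} ≤ C_p ε^{2/p} / d_ε^{(1+μ)/p}. -/
open MeasureTheory Set Metric
open scoped ENNReal

noncomputable section

/-- The plane `ℝ²`. -/
abbrev Pt : Type := EuclideanSpace ℝ (Fin 2)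

/-- Standard basis vectors of `ℝ²`. -/
def e2 (i : Fin 2) : Pt := EuclideanSpace.single i (1 : ℝ)

/-- Divergence of a planar vector field. -/
def div2 (u : Pt → Pt) (x : Pt) : ℝ := ∑ i, fderiv ℝ u x (e2 i) i

/-- Scalar curl of a planar vector field. -/
def curl2 (u : Pt → Pt) (x : Pt) : ℝ :=
  fderiv ℝ u x (e2 0) 1 - fderiv ℝ u x (e2 1) 0

/-- Gradient of a scalar field on the plane. -/
def grad2 (f : Pt → ℝ) (x : Pt) : Pt := ∑ i, fderiv ℝ f x (e2 i) • e2 i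

/-- Componentwise Laplacian of a planar vector field. -/
def lap2 (u : Pt → Pt) (x : Pt) : Pt :=
  ∑ i, fderiv ℝ (fun y => fderiv ℝ u y (e2 i)) x (e2 i)

/-- Laplacian of a scalar field. -/
def lapS (f : Pt → ℝ) (x : Pt) : ℝ :=
  ∑ i, fderiv ℝ (fun y => fderiv ℝ f y (e2 i)) x (e2 i)

/-- Rotation of a vector by `π/2`: `v^⊥ = (-v₂, v₁)`. -/
def perp2 (v : Pt) : Pt := (-(v 1)) • e2 0 + (v 0) • e2 1

/-- Euclidean inner product on the plane. -/
def dot2 (a b : Pt) : ℝ := inner ℝ a b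

/-- Biot–Savart law in the full plane. -/
def biotSavart (ω : Pt → ℝ) (x : Pt) : Pt :=
  ∫ y : Pt, ((2 * Real.pi)⁻¹ * ω y * (‖x - y‖ ^ 2)⁻¹) • perp2 (x - y)

/-- Frobenius norm of a linear map on `ℝ²` (the norm of the gradient matrix). -/
def frob2 (A : Pt →L[ℝ] Pt) : ℝ := Real.sqrt (∑ i, ∑ j, (A (e2 j) i) ^ 2)

/-- `L^p` norm (real-valued) of a vector field on a set. -/
def lpV (S : Set Pt) (p : ℝ≥0∞) (u : Pt → Pt) : ℝ :=
  (eLpNorm u p (volume.restrict S)).toReal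

/-- `L^p` norm (real-valued) of a scalar function on a set. -/
def lpS (S : Set Pt) (p : ℝ≥0∞) (f : Pt → ℝ) : ℝ :=
  (eLpNorm f p (volume.restrict S)).toReal

/-- `L^p` norm of the (Frobenius) gradient of a vector field on a set. -/
def gradLp (S : Set Pt) (p : ℝ≥0∞) (u : Pt → Pt) : ℝ :=
  lpS S p (fun x => frob2 (fderiv ℝ u x))

/-- The norm `‖f‖_{L¹∩L^∞(ℝ²)}`. -/
def normL1Linf (f : Pt → ℝ) : ℝ :=
  max (eLpNorm f 1 volume).toReal (eLpNorm f ⊤ volume).toReal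

/-- The norm `‖f‖_{L¹∩W^{1,∞}(ℝ²)}`. -/
def normL1W1inf (f : Pt → ℝ) : ℝ :=
  max (normL1Linf f) (eLpNorm (fun x => ‖grad2 f x‖) ⊤ volume).toReal

/-- Number of obstacles in the horizontal direction. -/
def nH (ε d : ℝ) : ℕ := ⌊(1 + 2 * d) / (2 * (ε + d))⌋₊

/-- Number of obstacles in the vertical direction. -/
def nV (ε d μ : ℝ) : ℕ := ⌊(nH ε d : ℝ) ^ μ⌋₊

/-- Center `z_{i,j}^ε` of an inclusion. -/
def obsCenter (ε d : ℝ) (i j : ℕ) : Pt :=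
  (ε + 2 * (ε + d) * ((i : ℝ) - 1)) • e2 0 + (ε + 2 * (ε + d) * ((j : ℝ) - 1)) • e2 1

/-- The inclusion `K_{i,j}^ε = z_{i,j}^ε + εK`. -/
def obstacleIJ (K : Set Pt) (ε d : ℝ) (i j : ℕ) : Set Pt :=
  (fun x => obsCenter ε d i j + ε • x) '' K

/-- The perforated fluid domain `Ω^ε`. -/
def fluidDomain (K : Set Pt) (ε d μ : ℝ) : Set Pt :=
  (⋃ i ∈ Finset.Icc 1 (nH ε d), ⋃ j ∈ Finset.Icc 1 (nV ε d μ),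
    obstacleIJ K ε d i j)ᶜ

/-- The open square `(-r,r)²`. -/
def squareLt (r : ℝ) : Set Pt := {x : Pt | max |x 0| |x 1| < r}

/-- The punctured cell `U = (-2,2)² \ K`. -/
def unitCell (K : Set Pt) : Set Pt := squareLt 2 \ K

/-- The rescaled translated cell `z_{i,j}^ε + εU`. -/
def cellAt (K : Set Pt) (ε d : ℝ) (i j : ℕ) : Set Pt :=
  (fun x => obsCenter ε d i j + ε • x) '' unitCell K

/-- The union of cells `A_ε`. -/
def Aeps (K : Set Pt) (ε d μ : ℝ) : Set Pt :=
  ⋃ i ∈ Finset.Icc 1 (nH ε d), ⋃ j ∈ Finset.Icc 1 (nV ε d μ), cellAt K ε d i j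

/-- Geometric assumptions on the obstacle shape `K`
(connected, simply connected, compact, contained in `[-1,1]²`, `0` interior). -/
structure ObstacleShape (K : Set Pt) : Prop where
  compact : IsCompact K
  connected : IsConnected K
  simplyConn : SimplyConnectedSpace K
  subset : ∀ x ∈ K, max |x 0| |x 1| ≤ 1
  zeroMem : (0 : Pt) ∈ interior K

/-- A smooth cutoff `φ` with `φ ≡ 1` on `{|x|_∞ ≤ 3/2}` and `φ ≡ 0` on `{|x|_∞ ≥ 2}`. -/
structure IsCutoff (φ : Pt → ℝ) : Prop where
  smooth : ContDiff ℝ (⊤ : ℕ∞) φ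
  mem_Icc : ∀ x, φ x ∈ Icc (0 : ℝ) 1
  eq_one : ∀ x : Pt, max |x 0| |x 1| ≤ 3 / 2 → φ x = 1
  eq_zero : ∀ x : Pt, 2 ≤ max |x 0| |x 1| → φ x = 0

/-- The perforated-domain cutoff `φ^ε`. -/
def phiEps (φ : Pt → ℝ) (ε d μ : ℝ) (x : Pt) : ℝ :=
  1 - ∑ i ∈ Finset.Icc 1 (nH ε d), ∑ j ∈ Finset.Icc 1 (nV ε d μ),
      φ (ε⁻¹ • (x - obsCenter ε d i j))

/-- Admissible geometric parameters: `0 < ε ≤ d_ε ≤ 1`, `0 ≤ μ ≤ 1`. -/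
structure GoodParams (ε d μ : ℝ) : Prop where
  pos : 0 < ε
  le : ε ≤ d
  le_one : d ≤ 1
  mu_nonneg : 0 ≤ μ
  mu_le_one : μ ≤ 1

/-- A smooth cutoff on balls: `χ ≡ 1` on `B(0,3)`, `χ ≡ 0` outside `B(0,4)`. -/
structure IsBallCutoff (χ : Pt → ℝ) : Prop where
  smooth : ContDiff ℝ (⊤ : ℕ∞) χ
  eq_one : ∀ x ∈ closedBall (0 : Pt) 3, χ x = 1
  eq_zero : ∀ x ∉ ball (0 : Pt) 4, χ x = 0

/-- `w` belongs to `H¹₀(Ω)` (encoded via continuity up to the boundary,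
pointwise differentiability inside, and vanishing boundary values). -/
def MemH10Loc (Ω : Set Pt) (w : Pt → Pt) : Prop :=
  ContinuousOn w (closure Ω) ∧ (∀ x ∈ Ω, DifferentiableAt ℝ w x) ∧
    ∀ x ∈ frontier Ω, w x = 0

/-- `Dh` is the (global, distributional) derivative of `h`. -/
def IsWeakFDeriv (h : Pt → Pt) (Dh : Pt → Pt →L[ℝ] Pt) : Prop :=
  ∀ g : Pt → ℝ, ContDiff ℝ (⊤ : ℕ∞) g → HasCompactSupport g → ∀ v : Pt,
    ∫ x : Pt, fderiv ℝ g x v • h x = - ∫ x : Pt, g x • Dh x v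

/-- The rescaled `W^{1,p}_ε`-norm on `A_ε` of a function `h` with weak gradient `Dh`. -/
def W1pEpsNorm (K : Set Pt) (ε d μ p : ℝ) (h : Pt → Pt) (Dh : Pt → Pt →L[ℝ] Pt) : ℝ :=
  ((ε ^ p)⁻¹ * (∫ x in Aeps K ε d μ, ‖h x‖ ^ p)
      + ∫ x in Aeps K ε d μ, frob2 (Dh x) ^ p) ^ (1 / p)

/-- Circulation of a vector field along the circle `∂B(z,r)`. -/
def circOnCircle (u : Pt → Pt) (z : Pt) (r : ℝ) : ℝ :=
  ∫ θ in (0 : ℝ)..(2 * Real.pi),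
    r * dot2 (u (z + (r * Real.cos θ) • e2 0 + (r * Real.sin θ) • e2 1))
          ((-Real.sin θ) • e2 0 + (Real.cos θ) • e2 1)

/-- `u` is the vector field on `Ω^ε` with vorticity `ω`, tangent to the boundary,
with zero circulation around each inclusion, vanishing at infinity. -/
structure IsPerforatedBiotSavart (K : Set Pt) (ε d μ : ℝ) (ω : Pt → ℝ) (u : Pt → Pt) :
    Prop where
  diffOn : ∀ x ∈ fluidDomain K ε d μ, DifferentiableAt ℝ u x
  divFree : ∀ x ∈ fluidDomain K ε d μ, div2 u x = 0
  curlEq : ∀ x ∈ fluidDomain K ε d μ, curl2 u x = ω x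
  tangent : ∀ g : Pt → ℝ, ContDiff ℝ (⊤ : ℕ∞) g → HasCompactSupport g →
    ∫ x in fluidDomain K ε d μ, dot2 (u x) (grad2 g x) = 0
  circulation : ∀ i ∈ Finset.Icc 1 (nH ε d), ∀ j ∈ Finset.Icc 1 (nV ε d μ),
    circOnCircle u (obsCenter ε d i j) (2 * ε)
      = ∫ x in ball (obsCenter ε d i j) (2 * ε) ∩ fluidDomain K ε d μ, ω x
  decay : Filter.Tendsto (fun x => ‖u x‖) (Filter.cocompact Pt) (nhds 0)

/-- Classical solution of the incompressible Euler equations on `[0,∞) × ℝ²`. -/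
structure IsEulerSolution (u : ℝ → Pt → Pt) (p : ℝ → Pt → ℝ) (u0 : Pt → Pt) : Prop where
  smooth_u : ∀ t, 0 ≤ t → ContDiff ℝ (⊤ : ℕ∞) (u t)
  smooth_p : ∀ t, 0 ≤ t → ContDiff ℝ (⊤ : ℕ∞) (p t)
  momentum : ∀ t, 0 ≤ t → ∀ x,
    deriv (fun s => u s x) t + fderiv ℝ (u t) x (u t x) + grad2 (p t) x = 0
  incompressible : ∀ t, 0 ≤ t → ∀ x, div2 (u t) x = 0
  init : u 0 = u0

/-- Solution of the Navier–Stokes equations on `Ω` with viscosity `ν`,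
no-slip boundary conditions and initial datum `u0`. -/
structure IsNSSolution (Ω : Set Pt) (ν : ℝ) (u : ℝ → Pt → Pt) (p : ℝ → Pt → ℝ)
    (u0 : Pt → Pt) : Prop where
  momentum : ∀ t, 0 < t → ∀ x ∈ Ω,
    deriv (fun s => u s x) t - ν • lap2 (u t) x + fderiv ℝ (u t) x (u t x)
      + grad2 (p t) x = 0
  incompressible : ∀ t, 0 ≤ t → ∀ x ∈ Ω, div2 (u t) x = 0
  noslip : ∀ t, 0 < t → ∀ x ∈ frontier Ω, u t x = 0
  init : ∀ x ∈ Ω, u 0 x = u0 x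

lemma aux_sq_ball (x : Pt) (h : max |x 0| |x 1| < 2) : ‖x‖ < 4 := by
  have h0 := (max_lt_iff.1 h).1
  have h1 := (max_lt_iff.1 h).2
  rw [EuclideanSpace.norm_eq, Fin.sum_univ_two, Real.sqrt_lt' (by norm_num)]
  simp only [Real.norm_eq_abs]
  have a0 := abs_nonneg (x 0)
  have a1 := abs_nonneg (x 1)
  nlinarith

lemma obsCenter_zero (ε d : ℝ) (i j : ℕ) :
    obsCenter ε d i j 0 = ε + 2 * (ε + d) * ((i : ℝ) - 1) := by
  simp [obsCenter, e2]

lemma obsCenter_one (ε d : ℝ) (i j : ℕ) :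
    obsCenter ε d i j 1 = ε + 2 * (ε + d) * ((j : ℝ) - 1) := by
  simp [obsCenter, e2]

/-- One-dimensional separation of the cells. -/
lemma aux_sep {ε d : ℝ} (h0 : 0 < ε) (h1 : ε ≤ d) (t : ℝ) (i k : ℕ)
    (hi : |ε⁻¹ * (t - (ε + 2 * (ε + d) * ((i : ℝ) - 1)))| < 2)
    (hk : |ε⁻¹ * (t - (ε + 2 * (ε + d) * ((k : ℝ) - 1)))| < 2) : i = k := by
  rw [abs_mul, abs_of_pos (inv_pos.2 h0), inv_mul_lt_iff₀ h0, abs_lt] at hi hk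
  rcases lt_trichotomy i k with h | h | h
  · exfalso
    have : (i : ℝ) + 1 ≤ k := by exact_mod_cast h
    nlinarith
  · exact h
  · exfalso
    have : (k : ℝ) + 1 ≤ i := by exact_mod_cast h
    nlinarith

/-- The union of balls containing the cells. -/
def auxA (ε d μ : ℝ) : Set Pt :=
  ⋃ q ∈ Finset.Icc 1 (nH ε d) ×ˢ Finset.Icc 1 (nV ε d μ), ball (obsCenter ε d q.1 q.2) (ε * 4)

lemma aux_pointwise {E : Type*} [NormedAddCommGroup E] (F : Pt → E) (M : ℝ)
    (hM : ∀ x, ‖F x‖ ≤ M) (hF : ∀ x : Pt, 2 ≤ max |x 0| |x 1| → F x = 0)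
    {ε d μ : ℝ} (h0 : 0 < ε) (h1 : ε ≤ d) (x : Pt) :
    ‖∑ i ∈ Finset.Icc 1 (nH ε d), ∑ j ∈ Finset.Icc 1 (nV ε d μ),
      F (ε⁻¹ • (x - obsCenter ε d i j))‖ ≤ ‖(auxA ε d μ).indicator (fun _ => M) x‖ := by
  rw [← Finset.sum_product' (f := fun i j => F (ε⁻¹ • (x - obsCenter ε d i j)))]
  by_cases hx : ∃ q ∈ Finset.Icc 1 (nH ε d) ×ˢ Finset.Icc 1 (nV ε d μ),
      F (ε⁻¹ • (x - obsCenter ε d q.1 q.2)) ≠ 0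
  · obtain ⟨q, hq, hne⟩ := hx
    have key : ∀ r : ℕ × ℕ, F (ε⁻¹ • (x - obsCenter ε d r.1 r.2)) ≠ 0 →
        max |(ε⁻¹ • (x - obsCenter ε d r.1 r.2)) 0|
          |(ε⁻¹ • (x - obsCenter ε d r.1 r.2)) 1| < 2 := by
      intro r hr
      by_contra hc
      exact hr (hF _ (not_lt.1 hc))
    have hmem : x ∈ auxA ε d μ := by
      refine mem_iUnion₂.2 ⟨q, hq, ?_⟩
      have := aux_sq_ball _ (key q hne)
      rw [norm_smul, Real.norm_eq_abs, abs_of_pos (inv_pos.2 h0), inv_mul_lt_iff₀ h0] at this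
      rwa [mem_ball, dist_eq_norm]
    rw [Finset.sum_eq_single_of_mem q hq, indicator_of_mem hmem]
    · exact (hM _).trans (le_abs_self M)
    · intro r _ hrq
      by_contra hr
      apply hrq
      have a := key r hr
      have b := key q hne
      simp only [PiLp.smul_apply, PiLp.sub_apply, smul_eq_mul, obsCenter_zero, obsCenter_one,
        max_lt_iff] at a b
      exact Prod.ext (aux_sep h0 h1 _ _ _ a.1 b.1) (aux_sep h0 h1 _ _ _ a.2 b.2)
  · push Not at hx
    rw [Finset.sum_eq_zero hx]
    simp

lemma aux_count {ε d μ : ℝ} (h : GoodParams ε d μ) :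
    (nH ε d : ℝ) * (nV ε d μ : ℝ) ≤ (d ^ (1 + μ))⁻¹ := by
  obtain ⟨h0, h1, h2, h3, h4⟩ := h
  have hd : 0 < d := h0.trans_le h1
  have hH : (nH ε d : ℝ) ≤ d⁻¹ := by
    have hfl : (nH ε d : ℝ) ≤ (1 + 2 * d) / (2 * (ε + d)) := Nat.floor_le (by positivity)
    rw [le_div_iff₀ (by positivity)] at hfl
    rcases Nat.lt_or_ge (nH ε d) 2 with hn | hn
    · have : (nH ε d : ℝ) ≤ 1 := by exact_mod_cast Nat.lt_succ_iff.1 hn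
      exact this.trans ((one_le_inv₀ hd).2 h2)
    · have : (2 : ℝ) ≤ nH ε d := by exact_mod_cast hn
      rw [← one_div, le_div_iff₀ hd]
      nlinarith
  have hV : (nV ε d μ : ℝ) ≤ (d⁻¹) ^ μ :=
    (Nat.floor_le (by positivity)).trans (Real.rpow_le_rpow (by positivity) hH h3)
  rw [← Real.inv_rpow hd.le, Real.rpow_add (inv_pos.2 hd), Real.rpow_one]
  exact mul_le_mul hH hV (by positivity) (by positivity)

lemma aux_vol {ε d μ : ℝ} (h : GoodParams ε d μ) :
    volume (auxA ε d μ) ≤ ENNReal.ofReal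
      ((d ^ (1 + μ))⁻¹ * (ε ^ 2 * (16 * (volume (ball (0 : Pt) 1)).toReal + 1))) := by
  have hd : 0 < d := h.pos.trans_le h.le
  have hb : ∀ z : Pt, volume (ball z (ε * 4)) ≤
      ENNReal.ofReal (ε ^ 2 * (16 * (volume (ball (0 : Pt) 1)).toReal + 1)) := by
    intro z
    rw [Measure.addHaar_ball _ _ (by linarith [h.pos]),
      ← ENNReal.ofReal_toReal (measure_ball_lt_top (μ := (volume : Measure Pt))).ne,
      ← ENNReal.ofReal_mul (by have := h.pos; positivity)]
    apply ENNReal.ofReal_le_ofReal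
    simp only [finrank_euclideanSpace, Fintype.card_fin]
    rw [ENNReal.toReal_ofReal ENNReal.toReal_nonneg]
    nlinarith [sq_nonneg ε]
  refine (measure_biUnion_finset_le _ _).trans ((Finset.sum_le_card_nsmul _ _ _
    (fun q _ => hb _)).trans ?_)
  rw [nsmul_eq_mul, ENNReal.ofReal_mul (p := (d ^ (1 + μ))⁻¹) (by positivity)]
  refine mul_le_mul' ?_ le_rfl
  rw [← ENNReal.ofReal_natCast]
  apply ENNReal.ofReal_le_ofReal
  simpa using aux_count h

lemma aux_lp {E : Type*} [NormedAddCommGroup E] (f : Pt → E) (M : ℝ) (hM : 0 ≤ M)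
    (p : ℝ≥0∞) {ε d μ : ℝ} (h : GoodParams ε d μ)
    (hf : ∀ x, ‖f x‖ ≤ ‖(auxA ε d μ).indicator (fun _ => M) x‖) :
    (eLpNorm f p volume).toReal ≤ M * (16 * (volume (ball (0 : Pt) 1)).toReal + 1) ^ (1 / p.toReal)
      * (ε ^ (2 / p.toReal) / d ^ ((1 + μ) / p.toReal)) := by
  have hd : 0 < d := h.pos.trans_le h.le
  have h0 := h.pos
  set W : ℝ := 16 * (volume (ball (0 : Pt) 1)).toReal + 1 with hW
  have hW0 : 0 < W := by positivity
  have hq : 0 ≤ 1 / p.toReal := by positivity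
  have e1 : eLpNorm f p volume ≤
      ENNReal.ofReal (M * ((d ^ (1 + μ))⁻¹ * (ε ^ 2 * W)) ^ (1 / p.toReal)) := by
    refine (eLpNorm_mono hf).trans ((eLpNorm_indicator_const_le M p).trans ?_)
    rw [ENNReal.ofReal_mul hM, ← ENNReal.ofReal_rpow_of_nonneg (by positivity) hq,
      Real.enorm_of_nonneg hM]
    gcongr
    exact aux_vol h
  refine (ENNReal.toReal_le_of_le_ofReal (by positivity) e1).trans (le_of_eq ?_)
  rw [Real.mul_rpow (by positivity) (by positivity), Real.mul_rpow (by positivity) hW0.le,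
    Real.inv_rpow (by positivity), ← Real.rpow_mul hd.le, ← Real.rpow_natCast ε 2,
    ← Real.rpow_mul h0.le, mul_one_div, mul_one_div, div_eq_mul_inv (ε ^ _)]
  push_cast
  ring

lemma aux_fderiv_zero {φ : Pt → ℝ} (hφ : IsCutoff φ) (x : Pt) (hx : 2 ≤ max |x 0| |x 1|) :
    fderiv ℝ φ x = 0 := by
  apply IsLocalMin.fderiv_eq_zero
  refine Filter.Eventually.of_forall fun y => ?_
  rw [hφ.eq_zero x hx]
  exact (hφ.mem_Icc y).1

lemma aux_grad_bound {φ : Pt → ℝ} (hφ : IsCutoff φ) : ∃ M : ℝ, 0 ≤ M ∧ ∀ x, ‖grad2 φ x‖ ≤ M := by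
  have hc : Continuous (grad2 φ) := by
    have := hφ.smooth.continuous_fderiv (by simp)
    unfold grad2
    fun_prop
  obtain ⟨M, hM⟩ := (isCompact_closedBall (0 : Pt) 4).exists_bound_of_continuousOn hc.continuousOn
  refine ⟨max M 0, le_max_right _ _, fun x => ?_⟩
  by_cases hx : 2 ≤ max |x 0| |x 1|
  · simp [grad2, aux_fderiv_zero hφ x hx]
  · refine (hM x ?_).trans (le_max_left _ _)
    rw [mem_closedBall_zero_iff]
    exact (aux_sq_ball x (not_le.1 hx)).le

lemma aux_grad_phiEps {φ : Pt → ℝ} (hφ : IsCutoff φ) (ε d μ : ℝ) (x : Pt) :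
    grad2 (phiEps φ ε d μ) x = -(ε⁻¹ • ∑ i ∈ Finset.Icc 1 (nH ε d),
      ∑ j ∈ Finset.Icc 1 (nV ε d μ), grad2 φ (ε⁻¹ • (x - obsCenter ε d i j))) := by
  have hd : Differentiable ℝ φ := hφ.smooth.differentiable (by simp)
  have h1 : ∀ z : Pt, HasFDerivAt (fun x => φ (ε⁻¹ • (x - z)))
      (ε⁻¹ • fderiv ℝ φ (ε⁻¹ • (x - z))) x := by
    intro z
    have a : HasFDerivAt (fun x : Pt => ε⁻¹ • (x - z)) (ε⁻¹ • ContinuousLinearMap.id ℝ Pt) x :=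
      ((hasFDerivAt_id x).sub_const z).const_smul ε⁻¹
    have b := (hd (ε⁻¹ • (x - z))).hasFDerivAt.comp x a
    have c : ε⁻¹ • fderiv ℝ φ (ε⁻¹ • (x - z)) =
        (fderiv ℝ φ (ε⁻¹ • (x - z))).comp (ε⁻¹ • ContinuousLinearMap.id ℝ Pt) := by
      ext v
      simp
    rw [c]
    exact b
  have h2 : HasFDerivAt (phiEps φ ε d μ) (-(∑ i ∈ Finset.Icc 1 (nH ε d),
      ∑ j ∈ Finset.Icc 1 (nV ε d μ), ε⁻¹ • fderiv ℝ φ (ε⁻¹ • (x - obsCenter ε d i j)))) x := by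
    unfold phiEps
    exact (HasFDerivAt.fun_sum fun i _ => HasFDerivAt.fun_sum fun j _ => h1 _).const_sub 1
  unfold grad2
  rw [h2.fderiv]
  simp only [Fin.sum_univ_two, neg_apply,
    sum_apply, smul_apply, ← Finset.smul_sum,
    Finset.sum_add_distrib, ← Finset.sum_smul, smul_add, smul_eq_mul, mul_smul, neg_smul, neg_add,
    ← Finset.mul_sum]

/-- `L^p` estimates for the cutoff `φ^ε` and its gradient. -/
theorem cutoff_lp_estimates (K : Set Pt) (hK : ObstacleShape K)
    (φ : Pt → ℝ) (hφ : IsCutoff φ) (p : ℝ≥0∞) (hp : 1 ≤ p) :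
    ∃ C > (0 : ℝ), ∀ (ε d μ : ℝ), GoodParams ε d μ →
      (eLpNorm (fun x => 1 - phiEps φ ε d μ x) p volume).toReal
        + ε * (eLpNorm (fun x => ‖grad2 (phiEps φ ε d μ) x‖) p volume).toReal
      ≤ C * ε ^ (2 / p.toReal) / d ^ ((1 + μ) / p.toReal) := by
  obtain ⟨M, hM0, hM⟩ := aux_grad_bound hφ
  refine ⟨(1 + M) * (16 * (volume (ball (0 : Pt) 1)).toReal + 1) ^ (1 / p.toReal),
    by positivity, fun ε d μ h => ?_⟩
  have h0 := h.pos
  have e1 := aux_lp (fun x => 1 - phiEps φ ε d μ x) 1 zero_le_one p h (fun x => by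
    have := aux_pointwise φ 1 (fun y => by
      rw [Real.norm_eq_abs, abs_of_nonneg (hφ.mem_Icc y).1]; exact (hφ.mem_Icc y).2)
      hφ.eq_zero h.pos h.le (μ := μ) x
    simpa only [phiEps, sub_sub_cancel] using this)
  have e2' := aux_lp (fun x => ‖grad2 (phiEps φ ε d μ) x‖) (ε⁻¹ * M) (by positivity) p h
    (fun x => by
      have := aux_pointwise (grad2 φ) M hM (fun y hy => by
        simp [grad2, aux_fderiv_zero hφ y hy]) h.pos h.le (μ := μ) x
      rw [norm_norm, aux_grad_phiEps hφ, norm_neg, norm_smul]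
      refine (mul_le_mul_of_nonneg_left this (norm_nonneg _)).trans (le_of_eq ?_)
      rw [← norm_mul]
      congr 1
      by_cases hx : x ∈ auxA ε d μ <;> simp [hx])
  have e3 := mul_le_mul_of_nonneg_left e2' h0.le
  refine (add_le_add e1 e3).trans (le_of_eq ?_)
  field_simp

end
end

section
/- Let ω₀ ∈ C_c^∞(ℝ²) be supported in Ω^ε, and let u₀^ε be a vector field on Ω^ε satisfying div u₀^ε = 0 and curl u₀^ε = ω₀ in Ω^ε, u₀^ε · n = 0 on ∂Ω^ε, zero circulation around each inclusion, and |u₀^ε(x)| → 0 as |x| → ∞ (and continuous up to the boundary). Then u₀^ε ∈ L^∞(Ω^ε) and u₀^ε belongs to the Marcinkiewicz weak-L² space L^{2,∞}(Ω^ε). -/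
open MeasureTheory Set Metric
open scoped ENNReal

noncomputable section

/-- Isometric identification of `ℂ` with the plane. -/
def toPt : ℂ ≃ₗᵢ[ℝ] Pt := Complex.orthonormalBasisOneI.repr

lemma toPt_one : toPt 1 = e2 0 := by
  have := Complex.orthonormalBasisOneI.repr_self 0
  simpa [toPt, e2] using this

lemma toPt_I : toPt Complex.I = e2 1 := by
  have := Complex.orthonormalBasisOneI.repr_self 1
  simpa [toPt, e2] using this

lemma toPt_symm (v : Pt) : toPt.symm v = (v 0 : ℂ) + (v 1 : ℂ) * Complex.I := by
  simp [toPt]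

/-- The complex velocity `u₁ - i u₂`. -/
def cvel (u : Pt → Pt) (z : ℂ) : ℂ := Complex.conjLIE (toPt.symm (u (toPt z)))

lemma norm_cvel (u : Pt → Pt) (z : ℂ) : ‖cvel u z‖ = ‖u (toPt z)‖ := by
  unfold cvel
  rw [LinearIsometryEquiv.norm_map, LinearIsometryEquiv.norm_map]

lemma cvel_differentiableAt (u : Pt → Pt) (z : ℂ) (hd : DifferentiableAt ℝ u (toPt z))
    (hdiv : div2 u (toPt z) = 0) (hcurl : curl2 u (toPt z) = 0) :
    DifferentiableAt ℂ (cvel u) z := by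
  set L : Pt →L[ℝ] ℂ :=
    ((toPt.symm.trans Complex.conjLIE).toContinuousLinearEquiv : Pt →L[ℝ] ℂ) with hL
  have h1 : HasFDerivAt (cvel u)
      (L.comp ((fderiv ℝ u (toPt z)).comp (toPt.toContinuousLinearEquiv : ℂ →L[ℝ] Pt))) z := by
    have ha : HasFDerivAt (fun z : ℂ => toPt z) (toPt.toContinuousLinearEquiv : ℂ →L[ℝ] Pt) z :=
      (toPt.toContinuousLinearEquiv : ℂ →L[ℝ] Pt).hasFDerivAt
    exact L.hasFDerivAt.comp z (hd.hasFDerivAt.comp z ha)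
  have hLv : ∀ v : Pt, L v = (v 0 : ℂ) - (v 1 : ℂ) * Complex.I := by
    intro v
    have : L v = Complex.conjLIE (toPt.symm v) := rfl
    rw [this, toPt_symm]
    simp [sub_eq_add_neg]
  rw [differentiableAt_complex_iff_differentiableAt_real]
  refine ⟨h1.differentiableAt, ?_⟩
  rw [h1.fderiv]
  have e1 : (toPt.toContinuousLinearEquiv : ℂ →L[ℝ] Pt) 1 = e2 0 := toPt_one
  have e3 : (toPt.toContinuousLinearEquiv : ℂ →L[ℝ] Pt) Complex.I = e2 1 := toPt_I
  simp only [ContinuousLinearMap.comp_apply, e1, e3, hLv]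
  simp only [div2, Fin.sum_univ_two] at hdiv
  simp only [curl2] at hcurl
  have a1 := eq_neg_of_add_eq_zero_right hdiv
  have a2 := sub_eq_zero.1 hcurl
  rw [a1, a2]
  apply Complex.ext <;> simp

/-- Decay at rate `1/|z|` of a function holomorphic near infinity and vanishing there. -/
lemma holo_decay (f : ℂ → ℂ) (hf : ∀ᶠ z in Bornology.cobounded ℂ, DifferentiableAt ℂ f z)
    (h0 : Filter.Tendsto f (Bornology.cobounded ℂ) (nhds 0)) :
    ∃ C : ℝ, ∀ᶠ z in Bornology.cobounded ℂ, ‖f z‖ * ‖z‖ ≤ C := by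
  classical
  set g : ℂ → ℂ := Function.update (fun w => f w⁻¹) 0 0 with hg
  have hev : ∀ w : ℂ, w ≠ 0 → g =ᶠ[nhds w] fun w => f w⁻¹ := by
    intro w hw
    filter_upwards [isOpen_ne.mem_nhds hw] with y hy
    exact Function.update_of_ne hy _ _
  have hd : ∀ᶠ w in nhdsWithin (0 : ℂ) {0}ᶜ, DifferentiableAt ℂ g w := by
    filter_upwards [Filter.tendsto_inv₀_nhdsNE_zero.eventually hf, self_mem_nhdsWithin]
      with w hw hw0
    have hw0' : w ≠ 0 := hw0
    exact (hw.comp w (differentiableAt_inv hw0')).congr_of_eventuallyEq (hev w hw0')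
  have hc : ContinuousAt g 0 := by
    rw [hg, continuousAt_update_same]
    exact h0.comp Filter.tendsto_inv₀_nhdsNE_zero
  have hdiff := (Complex.analyticAt_of_differentiable_on_punctured_nhds_of_continuousAt
    hd hc).differentiableAt
  obtain ⟨C, hC⟩ := hdiff.isBigO_sub.bound
  refine ⟨C, ?_⟩
  have ht : Filter.Tendsto (fun z : ℂ => z⁻¹) (Bornology.cobounded ℂ) (nhds 0) :=
    Filter.tendsto_inv₀_cobounded
  filter_upwards [ht.eventually hC, Bornology.eventually_ne_cobounded (0 : ℂ)] with z hz hz0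
  have hg0 : g 0 = 0 := Function.update_self _ _ _
  have hgz : g z⁻¹ = f z := by
    rw [hg, Function.update_of_ne (inv_ne_zero hz0), inv_inv]
  rw [hg0, hgz, sub_zero, sub_zero, norm_inv] at hz
  have hp : 0 < ‖z‖ := norm_pos_iff.2 hz0
  calc ‖f z‖ * ‖z‖ ≤ (C * ‖z‖⁻¹) * ‖z‖ := by gcongr
    _ = C := by field_simp

lemma fluid_compl_compact (K : Set Pt) (hK : IsCompact K) (ε d μ : ℝ) :
    IsCompact (fluidDomain K ε d μ)ᶜ := by
  unfold fluidDomain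
  rw [compl_compl]
  refine Finset.isCompact_biUnion _ fun i _ => Finset.isCompact_biUnion _ fun j _ => ?_
  exact hK.image (by fun_prop)

/-- the initial velocity `u₀^ε` belongs to `L^∞ ∩ L^{2,∞}(Ω^ε)`. -/
theorem initial_data_regularity (K : Set Pt) (hK : ObstacleShape K)
    (ε d μ : ℝ) (hpar : GoodParams ε d μ)
    (ω₀ : Pt → ℝ) (hω : ContDiff ℝ (⊤ : ℕ∞) ω₀) (hωc : HasCompactSupport ω₀)
    (hsupp : tsupport ω₀ ⊆ fluidDomain K ε d μ)
    (u0ε : Pt → Pt) (hu : IsPerforatedBiotSavart K ε d μ ω₀ u0ε)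
    (hcont : ContinuousOn u0ε (closure (fluidDomain K ε d μ))) :
    MemLp u0ε ⊤ (volume.restrict (fluidDomain K ε d μ)) ∧
    ∃ C : ℝ, ∀ lam > (0 : ℝ),
      lam ^ 2 * (volume {x ∈ fluidDomain K ε d μ | lam < ‖u0ε x‖}).toReal ≤ C := by
  have hcpt := fluid_compl_compact K hK.compact ε d μ
  set Ω := fluidDomain K ε d μ with hΩ
  have hopen : IsOpen Ω := isClosed_compl_iff.1 hcpt.isClosed
  have hΩev : ∀ᶠ x in Filter.cocompact Pt, x ∈ Ω := by
    simpa using hcpt.compl_mem_cocompact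
  have hωev : ∀ᶠ x in Filter.cocompact Pt, ω₀ x = 0 := by
    filter_upwards [hωc.isCompact.compl_mem_cocompact] with x hx
    exact image_eq_zero_of_notMem_tsupport hx
  have hT : Filter.Tendsto (fun z : ℂ => toPt z) (Bornology.cobounded ℂ)
      (Filter.cocompact Pt) := by
    rw [← Metric.cobounded_eq_cocompact, tendsto_norm_atTop_iff_cobounded.symm]
    simpa using (tendsto_norm_cobounded_atTop (E := ℂ))
  have hS : Filter.Tendsto (fun x : Pt => toPt.symm x) (Filter.cocompact Pt)
      (Bornology.cobounded ℂ) := by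
    rw [← Metric.cobounded_eq_cocompact, tendsto_norm_atTop_iff_cobounded.symm]
    simpa using (tendsto_norm_cobounded_atTop (E := Pt))
  -- decay at infinity
  obtain ⟨C, hC⟩ := holo_decay (cvel u0ε)
    (by
      filter_upwards [hT.eventually hΩev, hT.eventually hωev] with z hz hz'
      exact cvel_differentiableAt _ _ (hu.diffOn _ hz) (hu.divFree _ hz)
        ((hu.curlEq _ hz).trans hz'))
    (by
      rw [tendsto_zero_iff_norm_tendsto_zero]
      simp only [norm_cvel]
      exact hu.decay.comp hT)
  have hC' : ∀ᶠ x in Filter.cocompact Pt, ‖u0ε x‖ * ‖x‖ ≤ C := by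
    filter_upwards [hS.eventually hC] with x hx
    simpa [norm_cvel] using hx
  -- global bounds
  have key : ∀ f : Pt → ℝ, ContinuousOn f (closure Ω) → ∀ C : ℝ,
      (∀ᶠ x in Filter.cocompact Pt, f x ≤ C) → ∃ M, ∀ x ∈ Ω, f x ≤ M := by
    intro f hf C hfC
    obtain ⟨t, ht, hts⟩ := Filter.mem_cocompact.1 hfC
    obtain ⟨M, hM⟩ := (ht.inter_right (isClosed_closure (s := Ω))).bddAbove_image
      (hf.mono inter_subset_right)
    refine ⟨max M C, fun x hx => ?_⟩
    by_cases hxt : x ∈ t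
    · exact le_max_of_le_left (hM ⟨x, ⟨hxt, subset_closure hx⟩, rfl⟩)
    · exact le_max_of_le_right (hts hxt)
  obtain ⟨M, hM⟩ := key (fun x => ‖u0ε x‖) hcont.norm 1
    ((hu.decay.eventually (gt_mem_nhds one_pos)).mono fun x hx => le_of_lt hx)
  obtain ⟨B, hB⟩ := key (fun x => ‖u0ε x‖ * ‖x‖)
    (hcont.norm.mul continuous_norm.continuousOn) C hC'
  refine ⟨?_, ?_⟩
  · refine memLp_top_of_bound
      ((hcont.mono subset_closure).aestronglyMeasurable hopen.measurableSet) M ?_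
    exact (ae_restrict_iff' hopen.measurableSet).2 (Filter.Eventually.of_forall hM)
  · set B' := max B 0 with hB'
    have hB'0 : 0 ≤ B' := le_max_right _ _
    refine ⟨B' ^ 2 * (volume (ball (0 : Pt) 1)).toReal, fun lam hlam => ?_⟩
    have hsub : {x ∈ Ω | lam < ‖u0ε x‖} ⊆ closedBall (0 : Pt) (B' / lam) := by
      rintro x ⟨hx, hl⟩
      rw [mem_closedBall_zero_iff, le_div_iff₀ hlam]
      calc ‖x‖ * lam ≤ ‖x‖ * ‖u0ε x‖ := by gcongr
        _ = ‖u0ε x‖ * ‖x‖ := mul_comm _ _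
        _ ≤ B := hB x hx
        _ ≤ B' := le_max_left _ _
    have hvol : (volume (closedBall (0 : Pt) (B' / lam))).toReal
        = (B' / lam) ^ 2 * (volume (ball (0 : Pt) 1)).toReal := by
      rw [Measure.addHaar_closedBall _ _ (by positivity), ENNReal.toReal_mul,
        ENNReal.toReal_ofReal (by positivity)]
      simp
    have hle := ENNReal.toReal_mono (measure_closedBall_lt_top (μ := (volume : Measure Pt))
      (x := (0 : Pt)) (r := B' / lam)).ne (measure_mono (μ := volume) hsub)
    rw [hvol] at hle
    calc lam ^ 2 * (volume {x ∈ Ω | lam < ‖u0ε x‖}).toReal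
        ≤ lam ^ 2 * ((B' / lam) ^ 2 * (volume (ball (0 : Pt) 1)).toReal) := by gcongr
      _ = B' ^ 2 * (volume (ball (0 : Pt) 1)).toReal := by field_simp

end
end
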